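/- Suppose the full-space LFU problem is feasible and H̄ = Q Qᵀ H̄ Q Qᵀ. Let (α, H) be a minimizer of the full-space LFU problem and (α̂, Ĥ) a minimizer of the subspace LFU problem such that α = Q α̂. Then for every x̂ ∈ ℝᵈ and every v ∈ col(Q)⊥, the associated models satisfy m(x⁰ + Q x̂ + v) = m̂(x̂). -/

import Mathlib

open Matrix

/-- Squared Frobenius norm of a real matrix. -/
noncomputable def frobSq {a b : ℕ} (A : Matrix (Fin a) (Fin b) ℝ) : ℝ :=
  ∑ i, ∑ j, (A i j) ^ 2

/-- Squared Euclidean norm of a real vector. -/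
noncomputable def vecNormSq {a : ℕ} (v : Fin a → ℝ) : ℝ :=
  ∑ i, (v i) ^ 2

/-- `v` lies in the orthogonal complement of the column space of `Q`. -/
def inColPerp {n d : ℕ} (Q : Matrix (Fin n) (Fin d) ℝ) (v : Fin n → ℝ) : Prop :=
  ∀ u : Fin d → ℝ, Q.mulVec u ⬝ᵥ v = 0

/-- Feasibility for the quadratic interpolation constraints: `p = (α, H)` with `H`
symmetric and `(dᵢ)ᵀ α + ½ (dᵢ)ᵀ H dᵢ = rhs i` for all `i`. -/
def QFeas {k m : ℕ} (dd : Fin m → Fin k → ℝ) (rhs : Fin m → ℝ)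
    (p : (Fin k → ℝ) × Matrix (Fin k) (Fin k) ℝ) : Prop :=
  p.2.IsSymm ∧ ∀ i, dd i ⬝ᵥ p.1 + (1 / 2) * (dd i ⬝ᵥ p.2.mulVec (dd i)) = rhs i

/-- Objective of the minimum norm (MN) problem. -/
noncomputable def MNObj {k : ℕ} (p : (Fin k → ℝ) × Matrix (Fin k) (Fin k) ℝ) : ℝ :=
  (1 / 2) * vecNormSq p.1 + (1 / 2) * frobSq p.2

/-- `p` is a minimizer of the MN problem. -/
def MNMin {k m : ℕ} (dd : Fin m → Fin k → ℝ) (rhs : Fin m → ℝ)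
    (p : (Fin k → ℝ) × Matrix (Fin k) (Fin k) ℝ) : Prop :=
  QFeas dd rhs p ∧ ∀ q, QFeas dd rhs q → MNObj p ≤ MNObj q

/-- Objective of the minimum Frobenius norm (MFN) problem. -/
noncomputable def MFNObj {k : ℕ} (p : (Fin k → ℝ) × Matrix (Fin k) (Fin k) ℝ) : ℝ :=
  (1 / 2) * frobSq p.2

/-- `p` is a minimizer of the MFN problem. -/
def MFNMin {k m : ℕ} (dd : Fin m → Fin k → ℝ) (rhs : Fin m → ℝ)
    (p : (Fin k → ℝ) × Matrix (Fin k) (Fin k) ℝ) : Prop :=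
  QFeas dd rhs p ∧ ∀ q, QFeas dd rhs q → MFNObj p ≤ MFNObj q

/-- Objective of the least Frobenius norm updating (LFU) problem. -/
noncomputable def LFUObj {k : ℕ} (Hbar : Matrix (Fin k) (Fin k) ℝ)
    (p : (Fin k → ℝ) × Matrix (Fin k) (Fin k) ℝ) : ℝ :=
  (1 / 2) * frobSq (p.2 - Hbar)

/-- `p` is a minimizer of the LFU problem with reference matrix `Hbar`. -/
def LFUMin {k m : ℕ} (dd : Fin m → Fin k → ℝ) (rhs : Fin m → ℝ)
    (Hbar : Matrix (Fin k) (Fin k) ℝ)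
    (p : (Fin k → ℝ) × Matrix (Fin k) (Fin k) ℝ) : Prop :=
  QFeas dd rhs p ∧ ∀ q, QFeas dd rhs q → LFUObj Hbar p ≤ LFUObj Hbar q

/-- `X` is a Moore–Penrose pseudoinverse of `A`. -/
def IsMPInv {a b : ℕ} (A : Matrix (Fin a) (Fin b) ℝ) (X : Matrix (Fin b) (Fin a) ℝ) : Prop :=
  A * X * A = A ∧ X * A * X = X ∧ (A * X)ᵀ = A * X ∧ (X * A)ᵀ = X * A

/-- The vector `δ_g(y⁰; W)` with `i`-th entry `g(y⁰ + wⁱ) − g(y⁰)`,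
where `wⁱ` is the `i`-th column of `W`. -/
noncomputable def deltaVec {k p : ℕ} (g : (Fin k → ℝ) → ℝ) (y0 : Fin k → ℝ)
    (W : Matrix (Fin k) (Fin p) ℝ) : Fin p → ℝ :=
  fun i => g (y0 + fun j => W j i) - g y0

theorem frobSq_eq_trace {a b : ℕ} (A : Matrix (Fin a) (Fin b) ℝ) :
    frobSq A = (Aᵀ * A).trace := by
  simp only [frobSq, Matrix.trace, Matrix.diag, Matrix.mul_apply, Matrix.transpose_apply]
  rw [Finset.sum_comm]
  simp [sq]

theorem frobSq_nonneg {a b : ℕ} (A : Matrix (Fin a) (Fin b) ℝ) : 0 ≤ frobSq A :=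
  Finset.sum_nonneg fun _ _ => Finset.sum_nonneg fun _ _ => sq_nonneg _

theorem eq_zero_of_frobSq_nonpos {a b : ℕ} {A : Matrix (Fin a) (Fin b) ℝ}
    (h : frobSq A ≤ 0) : A = 0 := by
  rw [frobSq_eq_trace] at h
  have h0 : (Aᵀ * A).trace = 0 :=
    le_antisymm h (by rw [← frobSq_eq_trace]; exact frobSq_nonneg A)
  rwa [← conjTranspose_eq_transpose_of_trivial, trace_conjTranspose_mul_self_eq_zero_iff] at h0

theorem frobSq_smul {a b : ℕ} (c : ℝ) (A : Matrix (Fin a) (Fin b) ℝ) :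
    frobSq (c • A) = c ^ 2 * frobSq A := by
  simp [frobSq, mul_pow, Finset.mul_sum]

theorem frobSq_add {a b : ℕ} (A B : Matrix (Fin a) (Fin b) ℝ) :
    frobSq (A + B) = frobSq A + 2 * (Aᵀ * B).trace + frobSq B := by
  have h : (Bᵀ * A).trace = (Aᵀ * B).trace := by
    rw [← trace_transpose, transpose_mul, transpose_transpose]
  simp only [frobSq_eq_trace, transpose_add, Matrix.add_mul, Matrix.mul_add, trace_add, h]
  ring

theorem frobSq_sub {a b : ℕ} (A B : Matrix (Fin a) (Fin b) ℝ) :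
    frobSq (A - B) = frobSq A - 2 * (Aᵀ * B).trace + frobSq B := by
  have h := frobSq_smul (-1) B
  rw [neg_one_smul] at h
  rw [sub_eq_add_neg, frobSq_add, h, Matrix.mul_neg, trace_neg]
  ring

theorem trace_transpose_mul_conj {n d : ℕ} (Q : Matrix (Fin n) (Fin d) ℝ)
    (A : Matrix (Fin n) (Fin n) ℝ) (B : Matrix (Fin d) (Fin d) ℝ) :
    (Aᵀ * (Q * B * Qᵀ)).trace = ((Qᵀ * A * Q)ᵀ * B).trace := by
  simp only [transpose_mul, transpose_transpose]
  rw [← Matrix.mul_assoc, trace_mul_comm]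
  simp only [Matrix.mul_assoc]

theorem transpose_conj_conj {n d : ℕ} {Q : Matrix (Fin n) (Fin d) ℝ} (hQ : Qᵀ * Q = 1)
    (B : Matrix (Fin d) (Fin d) ℝ) : Qᵀ * (Q * B * Qᵀ) * Q = B := by
  calc Qᵀ * (Q * B * Qᵀ) * Q = (Qᵀ * Q) * B * (Qᵀ * Q) := by simp only [Matrix.mul_assoc]
    _ = B := by rw [hQ, Matrix.one_mul, Matrix.mul_one]

theorem frobSq_conj {n d : ℕ} {Q : Matrix (Fin n) (Fin d) ℝ} (hQ : Qᵀ * Q = 1)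
    (B : Matrix (Fin d) (Fin d) ℝ) : frobSq (Q * B * Qᵀ) = frobSq B := by
  rw [frobSq_eq_trace, trace_transpose_mul_conj, transpose_conj_conj hQ, frobSq_eq_trace]

/-- Compression to the column space of `Q` does not increase the Frobenius norm. -/
theorem frobSq_compress_le {n d : ℕ} {Q : Matrix (Fin n) (Fin d) ℝ} (hQ : Qᵀ * Q = 1)
    (A : Matrix (Fin n) (Fin n) ℝ) : frobSq (Qᵀ * A * Q) ≤ frobSq A := by
  have h := frobSq_nonneg (A - Q * (Qᵀ * A * Q) * Qᵀ)
  rw [frobSq_sub, frobSq_conj hQ, trace_transpose_mul_conj, ← frobSq_eq_trace] at h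
  linarith

theorem mulVec_dotProduct_eq {n d : ℕ} (Q : Matrix (Fin n) (Fin d) ℝ) (u : Fin d → ℝ)
    (w : Fin n → ℝ) : Q *ᵥ u ⬝ᵥ w = u ⬝ᵥ Qᵀ *ᵥ w := by
  rw [dotProduct_comm, dotProduct_mulVec, ← mulVec_transpose, dotProduct_comm]

theorem dotProduct_conj_mulVec {n d : ℕ} (Q : Matrix (Fin n) (Fin d) ℝ)
    (B : Matrix (Fin d) (Fin d) ℝ) (w : Fin n → ℝ) :
    w ⬝ᵥ (Q * B * Qᵀ) *ᵥ w = Qᵀ *ᵥ w ⬝ᵥ B *ᵥ (Qᵀ *ᵥ w) := by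
  rw [← mulVec_mulVec, ← mulVec_mulVec, dotProduct_comm, mulVec_dotProduct_eq, dotProduct_comm]

theorem isSymm_conj {n d : ℕ} (Q : Matrix (Fin n) (Fin d) ℝ) {B : Matrix (Fin d) (Fin d) ℝ}
    (hB : B.IsSymm) : (Q * B * Qᵀ).IsSymm := by
  simp only [Matrix.IsSymm, transpose_mul, transpose_transpose, hB.eq, Matrix.mul_assoc]

theorem transpose_mulVec_mulVec {n d : ℕ} {Q : Matrix (Fin n) (Fin d) ℝ} (hQ : Qᵀ * Q = 1)
    (u : Fin d → ℝ) : Qᵀ *ᵥ (Q *ᵥ u) = u := by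
  rw [mulVec_mulVec, hQ, one_mulVec]

theorem QFeas.lift {n d m : ℕ} {Q : Matrix (Fin n) (Fin d) ℝ} (hQ : Qᵀ * Q = 1)
    {dh : Fin m → Fin d → ℝ} {rhs : Fin m → ℝ} {αh : Fin d → ℝ}
    {Hh : Matrix (Fin d) (Fin d) ℝ} (h : QFeas dh rhs (αh, Hh)) :
    QFeas (fun i => Q *ᵥ dh i) rhs (Q *ᵥ αh, Q * Hh * Qᵀ) := by
  refine ⟨isSymm_conj Q h.1, fun i => ?_⟩
  simpa only [dotProduct_conj_mulVec, transpose_mulVec_mulVec hQ, mulVec_dotProduct_eq]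
    using h.2 i

theorem QFeas.compress {n d m : ℕ} {Q : Matrix (Fin n) (Fin d) ℝ}
    {dh : Fin m → Fin d → ℝ} {rhs : Fin m → ℝ} {α : Fin n → ℝ}
    {H : Matrix (Fin n) (Fin n) ℝ} (h : QFeas (fun i => Q *ᵥ dh i) rhs (α, H)) :
    QFeas dh rhs (Qᵀ *ᵥ α, Qᵀ * H * Q) := by
  refine ⟨by simpa using isSymm_conj Qᵀ h.1, fun i => ?_⟩
  have h2 := h.2 i
  simpa only [mulVec_dotProduct_eq, mulVec_mulVec, Matrix.mul_assoc] using h2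

theorem QFeas.midpoint {k m : ℕ} {dd : Fin m → Fin k → ℝ} {rhs : Fin m → ℝ}
    {p q : (Fin k → ℝ) × Matrix (Fin k) (Fin k) ℝ} (hp : QFeas dd rhs p)
    (hq : QFeas dd rhs q) : QFeas dd rhs ((1 / 2 : ℝ) • (p + q)) := by
  refine ⟨?_, fun i => ?_⟩
  · exact (hp.1.add hq.1).smul _
  · have h1 := hp.2 i
    have h2 := hq.2 i
    simp only [Prod.smul_fst, Prod.smul_snd, Prod.fst_add, Prod.snd_add, smul_mulVec,
      add_mulVec, dotProduct_smul, dotProduct_add, smul_eq_mul]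
    linarith

/-- The Hessian of a minimizer of the LFU problem is unique. -/
theorem LFUMin.hessian_eq {k m : ℕ} {dd : Fin m → Fin k → ℝ} {rhs : Fin m → ℝ}
    {Hbar : Matrix (Fin k) (Fin k) ℝ} {p q : (Fin k → ℝ) × Matrix (Fin k) (Fin k) ℝ}
    (hp : LFUMin dd rhs Hbar p) (hq : QFeas dd rhs q)
    (hqp : LFUObj Hbar q ≤ LFUObj Hbar p) : p.2 = q.2 := by
  have h := hp.2 _ (hp.1.midpoint hq)
  have e : ((1 / 2 : ℝ) • (p + q)).2 - Hbar =
      (1 / 2 : ℝ) • ((p.2 - Hbar) + (q.2 - Hbar)) := by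
    simp only [Prod.smul_snd, Prod.snd_add]
    module
  have e' : p.2 - q.2 = (p.2 - Hbar) - (q.2 - Hbar) := by abel
  simp only [LFUObj, e, frobSq_smul, frobSq_add] at h hqp
  refine sub_eq_zero.mp (eq_zero_of_frobSq_nonpos ?_)
  rw [e', frobSq_sub]
  linarith

/-- If the full-space LFU problem is feasible, `H̄ = Q Qᵀ H̄ Q Qᵀ`,
`(α, H)` is a minimizer of the full-space LFU problem, `(α̂, Ĥ)` is a minimizer of
the subspace LFU problem, and `α = Q α̂`, then `m(x⁰ + Q x̂ + v) = m̂(x̂)` for every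
`x̂ ∈ ℝᵈ` and every `v ∈ col(Q)⊥`. -/
theorem stmt_12 {n d m : ℕ} (hn : 0 < n) (hd : 0 < d) (hm : 0 < m) (hdn : d < n)
    (Q : Matrix (Fin n) (Fin d) ℝ) (hQ : Qᵀ * Q = 1)
    (f : (Fin n → ℝ) → ℝ) (x0 : Fin n → ℝ) (dh : Fin m → Fin d → ℝ)
    (fh : (Fin d → ℝ) → ℝ) (hfh : ∀ xh, fh xh = f (x0 + Q.mulVec xh))
    (Hbar : Matrix (Fin n) (Fin n) ℝ) (hHbar : Hbar.IsSymm)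
    (hHbarQ : Hbar = Q * Qᵀ * Hbar * Q * Qᵀ)
    (hfeas : ∃ p, QFeas (fun i => Q.mulVec (dh i))
      (fun i => f (x0 + Q.mulVec (dh i)) - f x0) p)
    (α : Fin n → ℝ) (H : Matrix (Fin n) (Fin n) ℝ)
    (hmin : LFUMin (fun i => Q.mulVec (dh i))
      (fun i => f (x0 + Q.mulVec (dh i)) - f x0) Hbar (α, H))
    (αh : Fin d → ℝ) (Hh : Matrix (Fin d) (Fin d) ℝ)
    (hminh : LFUMin dh (fun i => fh (dh i) - fh 0) (Qᵀ * Hbar * Q) (αh, Hh))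
    (hrel : α = Q.mulVec αh) :
    ∀ (xh : Fin d → ℝ) (v : Fin n → ℝ), inColPerp Q v →
      f x0 + α ⬝ᵥ (x0 + Q.mulVec xh + v - x0)
        + (1 / 2) * ((x0 + Q.mulVec xh + v - x0) ⬝ᵥ H.mulVec (x0 + Q.mulVec xh + v - x0))
      = fh 0 + αh ⬝ᵥ xh + (1 / 2) * (xh ⬝ᵥ Hh.mulVec xh) := by
  have hf0 : fh 0 = f x0 := by rw [hfh, mulVec_zero, add_zero]
  have hrhs : (fun i => fh (dh i) - fh 0) = fun i => f (x0 + Q *ᵥ dh i) - f x0 := by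
    simp only [hfh, mulVec_zero, add_zero]
  rw [hrhs] at hminh
  have hH : H = Q * Hh * Qᵀ := by
    refine hmin.hessian_eq (hminh.1.lift hQ) ?_
    have hle := hminh.2 _ hmin.1.compress
    have hc := frobSq_compress_le hQ (H - Hbar)
    have e1 : Q * Hh * Qᵀ - Hbar = Q * (Hh - Qᵀ * Hbar * Q) * Qᵀ := by
      conv_lhs => rw [hHbarQ]
      simp only [Matrix.mul_sub, Matrix.sub_mul, Matrix.mul_assoc]
    rw [Matrix.mul_sub, Matrix.sub_mul] at hc
    simp only [LFUObj] at hle ⊢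
    rw [e1, frobSq_conj hQ]
    linarith
  intro xh v hv
  have hQv : Qᵀ *ᵥ v = 0 := by
    refine dotProduct_eq_zero _ fun u => ?_
    rw [dotProduct_comm, ← mulVec_dotProduct_eq]
    exact hv u
  have hw : x0 + Q *ᵥ xh + v - x0 = Q *ᵥ xh + v := by abel
  rw [hw, hH, hrel, dotProduct_conj_mulVec, mulVec_dotProduct_eq, mulVec_add, hQv, add_zero,
    transpose_mulVec_mulVec hQ, hf0]
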